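/- arXiv:1711.03139 — 2 statements merged into one kernel-verified Lean document; each statement's English description precedes it below -/
import Mathlib

section
/- With the standard setup below (2 ≤ p ≤ q, reals a > b > 0 with a² − b² = 1, θ ∈ ℝ): for every integer k ≥ 1 with cos(kθ) ≠ 0, if −(a+b) ≤ tan(kθ) ≤ −(a−b), then every vector v belonging to P ∩ r^k(U₁) satisfies B(v,v) ≤ 0; that is, P ∩ r^k U₁ contains no vector of positive B-norm. -/
open Real

/-- The diagonal weights of the form `B` of signature `(p, q)`: `+1` on the `e`-coordinates,
`−1` on the `f`-coordinates. -/
def sigWeights (p q : ℕ) : Fin p ⊕ Fin q → ℝ :=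
  Sum.elim (fun _ => 1) (fun _ => -1)

/-- The symmetric bilinear form `B` of signature `(p, q)` on `ℝ^{p+q}`, with
`B(e_i, e_i) = 1`, `B(f_j, f_j) = −1` and distinct basis vectors orthogonal. -/
noncomputable def formB (p q : ℕ) :
    LinearMap.BilinForm ℝ ((Fin p ⊕ Fin q) → ℝ) :=
  Matrix.toLinearMap₂' ℝ (Matrix.diagonal (sigWeights p q))

/-- The basis vector `e_i`. -/
def eVec (p q : ℕ) (i : Fin p) : (Fin p ⊕ Fin q) → ℝ := Pi.single (Sum.inl i) 1

/-- The basis vector `f_j`. -/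
def fVec (p q : ℕ) (j : Fin q) : (Fin p ⊕ Fin q) → ℝ := Pi.single (Sum.inr j) 1

/-- The plane `U_i = span{e_i, f_i}` (for `1 ≤ i ≤ p`, using `p ≤ q`). -/
def planeU (p q : ℕ) (hpq : p ≤ q) (i : Fin p) : Submodule ℝ ((Fin p ⊕ Fin q) → ℝ) :=
  Submodule.span ℝ {eVec p q i, fVec p q (Fin.castLE hpq i)}

/-- The vector `λ = b e₁ + a f₁ + f₂ + ⋯ + f_p`. -/
noncomputable def lamVec (p q : ℕ) (hp : 0 < p) (hpq : p ≤ q) (a b : ℝ) :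
    (Fin p ⊕ Fin q) → ℝ :=
  b • eVec p q ⟨0, hp⟩ + a • fVec p q (Fin.castLE hpq ⟨0, hp⟩) +
    ∑ j ∈ Finset.univ.erase (⟨0, hp⟩ : Fin p), fVec p q (Fin.castLE hpq j)

/-- The subspace `P = λ^⊥`, the `B`-orthogonal complement of the line spanned by `λ`. -/
noncomputable def hyperP (p q : ℕ) (hp : 0 < p) (hpq : p ≤ q) (a b : ℝ) :
    Submodule ℝ ((Fin p ⊕ Fin q) → ℝ) :=
  LinearMap.ker (formB p q (lamVec p q hp hpq a b))

/-- The rotation `r` by angle `θ` in the `(e₁, e₂)`- and `(f₁, f₂)`-planes, fixing all other basis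
vectors. -/
noncomputable def rotR (p q : ℕ) (hp : 2 ≤ p) (hq : 2 ≤ q) (θ : ℝ) :
    Module.End ℝ ((Fin p ⊕ Fin q) → ℝ) :=
  (Pi.basisFun ℝ (Fin p ⊕ Fin q)).constr ℝ fun i =>
    if i = Sum.inl ⟨0, by omega⟩ then
      Real.cos θ • eVec p q ⟨0, by omega⟩ + Real.sin θ • eVec p q ⟨1, by omega⟩
    else if i = Sum.inl ⟨1, by omega⟩ then
      (-Real.sin θ) • eVec p q ⟨0, by omega⟩ + Real.cos θ • eVec p q ⟨1, by omega⟩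
    else if i = Sum.inr ⟨0, by omega⟩ then
      Real.cos θ • fVec p q ⟨0, by omega⟩ + Real.sin θ • fVec p q ⟨1, by omega⟩
    else if i = Sum.inr ⟨1, by omega⟩ then
      (-Real.sin θ) • fVec p q ⟨0, by omega⟩ + Real.cos θ • fVec p q ⟨1, by omega⟩
    else Pi.single i 1

/-- The existence of a `p`-dimensional `B`-positive-definite subspace `V' ⊆ P` that is the
(direct) sum of its intersections with the given family `W` of subspaces. -/
def ExistsGoodSubspace (p q : ℕ) (P : Submodule ℝ ((Fin p ⊕ Fin q) → ℝ))
    (W : Fin p → Submodule ℝ ((Fin p ⊕ Fin q) → ℝ)) : Prop :=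
  ∃ V' : Submodule ℝ ((Fin p ⊕ Fin q) → ℝ), V' ≤ P ∧ Module.finrank ℝ ↥V' = p ∧
    (∀ v ∈ V', v ≠ 0 → 0 < formB p q v v) ∧ V' = ⨆ i, V' ⊓ W i

theorem formB_single_right {p q : ℕ} (u : (Fin p ⊕ Fin q) → ℝ) (i : Fin p ⊕ Fin q) :
    formB p q u (Pi.single i 1) = sigWeights p q i * u i := by
  simp [formB, Matrix.toLinearMap₂'_apply', mul_comm]

theorem formB_eVec {p q : ℕ} (u : (Fin p ⊕ Fin q) → ℝ) (i : Fin p) :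
    formB p q u (eVec p q i) = u (Sum.inl i) := by
  simp [eVec, formB_single_right, sigWeights]

theorem formB_fVec {p q : ℕ} (u : (Fin p ⊕ Fin q) → ℝ) (j : Fin q) :
    formB p q u (fVec p q j) = -u (Sum.inr j) := by
  simp [fVec, formB_single_right, sigWeights]

theorem lamVec_inl {p q : ℕ} (hp : 0 < p) (hpq : p ≤ q) (a b : ℝ) (i : Fin p) :
    lamVec p q hp hpq a b (Sum.inl i) = if i = ⟨0, hp⟩ then b else 0 := by
  simp [lamVec, eVec, fVec, Finset.sum_apply, Pi.single_apply]

theorem lamVec_inr_castLE {p q : ℕ} (hp : 0 < p) (hpq : p ≤ q) (a b : ℝ) (i : Fin p) :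
    lamVec p q hp hpq a b (Sum.inr (Fin.castLE hpq i)) = if i = ⟨0, hp⟩ then a else 1 := by
  by_cases h : i = ⟨0, hp⟩
  · subst h
    simp [lamVec, eVec, fVec, Finset.sum_apply, Pi.single_apply,
      (Fin.castLE_injective hpq).eq_iff, -Fin.castLE_mk]
  · simp [lamVec, eVec, fVec, Finset.sum_apply, Pi.single_apply,
      (Fin.castLE_injective hpq).eq_iff, h, -Fin.castLE_mk]

/-- The powers of an endomorphism acting on `u, w` as the rotation by `θ` act on `u` as the
rotations by the multiples of `θ`. -/
theorem Module.End.pow_apply_of_rotation {V : Type*} [AddCommGroup V] [Module ℝ V]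
    (T : Module.End ℝ V) (u w : V) (θ : ℝ)
    (hu : T u = Real.cos θ • u + Real.sin θ • w)
    (hw : T w = (-Real.sin θ) • u + Real.cos θ • w) (k : ℕ) :
    (T ^ k) u = Real.cos (k * θ) • u + Real.sin (k * θ) • w := by
  induction k with
  | zero => simp
  | succ k ih =>
    rw [pow_succ', Module.End.mul_apply, ih, map_add, map_smul, map_smul, hu, hw]
    push_cast
    rw [add_mul, one_mul, Real.cos_add, Real.sin_add]
    module

theorem rotR_single {p q : ℕ} (hp : 2 ≤ p) (hq : 2 ≤ q) (θ : ℝ) (i : Fin p ⊕ Fin q) :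
    rotR p q hp hq θ (Pi.single i 1) =
      if i = Sum.inl ⟨0, by omega⟩ then
        Real.cos θ • eVec p q ⟨0, by omega⟩ + Real.sin θ • eVec p q ⟨1, by omega⟩
      else if i = Sum.inl ⟨1, by omega⟩ then
        (-Real.sin θ) • eVec p q ⟨0, by omega⟩ + Real.cos θ • eVec p q ⟨1, by omega⟩
      else if i = Sum.inr ⟨0, by omega⟩ then
        Real.cos θ • fVec p q ⟨0, by omega⟩ + Real.sin θ • fVec p q ⟨1, by omega⟩
      else if i = Sum.inr ⟨1, by omega⟩ then
        (-Real.sin θ) • fVec p q ⟨0, by omega⟩ + Real.cos θ • fVec p q ⟨1, by omega⟩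
      else Pi.single i 1 := by
  rw [rotR, ← Pi.basisFun_apply ℝ, Module.Basis.constr_basis, Pi.basisFun_apply]

theorem rotR_pow_eVec_zero {p q : ℕ} (hp : 2 ≤ p) (hq : 2 ≤ q) (θ : ℝ) (k : ℕ) :
    (rotR p q hp hq θ ^ k) (eVec p q ⟨0, by omega⟩) =
      Real.cos (k * θ) • eVec p q ⟨0, by omega⟩ + Real.sin (k * θ) • eVec p q ⟨1, by omega⟩ := by
  apply Module.End.pow_apply_of_rotation
  · rw [eVec, rotR_single]
    simp [eVec]
  · rw [eVec, eVec, rotR_single]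
    simp [eVec]

theorem rotR_pow_fVec_zero {p q : ℕ} (hp : 2 ≤ p) (hq : 2 ≤ q) (θ : ℝ) (k : ℕ) :
    (rotR p q hp hq θ ^ k) (fVec p q ⟨0, by omega⟩) =
      Real.cos (k * θ) • fVec p q ⟨0, by omega⟩ + Real.sin (k * θ) • fVec p q ⟨1, by omega⟩ := by
  apply Module.End.pow_apply_of_rotation
  · rw [fVec, rotR_single]
    simp [fVec]
  · rw [fVec, fVec, rotR_single]
    simp [fVec]

/-- key computation in the proof of the intersection-pattern lemma. With
`2 ≤ p ≤ q`, `a > b > 0`, `a² − b² = 1` and `θ ∈ ℝ`: for every `k ≥ 1` with `cos (kθ) ≠ 0` and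
`−(a+b) ≤ tan (kθ) ≤ −(a−b)`, every vector of `P ∩ r^k(U₁)` has nonpositive `B`-norm. -/
theorem no_positive_vector_in_rotated_plane
    (p q : ℕ) (hp : 2 ≤ p) (hpq : p ≤ q) (a b θ : ℝ)
    (hba : b < a) (hb : 0 < b) (hab : a ^ 2 - b ^ 2 = 1) :
    ∀ k : ℕ, 1 ≤ k → Real.cos (k * θ) ≠ 0 →
      -(a + b) ≤ Real.tan (k * θ) → Real.tan (k * θ) ≤ -(a - b) →
      ∀ v ∈ hyperP p q (by omega) hpq a b ⊓
        (planeU p q hpq ⟨0, by omega⟩).map (rotR p q hp (hp.trans hpq) θ ^ k),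
        formB p q v v ≤ 0 := by
  intro k _ hc h₁ h₂ v hv
  obtain ⟨hvP, w, hw, rfl⟩ := hv
  obtain ⟨x, y, rfl⟩ := Submodule.mem_span_pair.mp hw
  have hP : formB p q (lamVec p q (by omega) hpq a b) _ = 0 := LinearMap.mem_ker.mp hvP
  have l₁ := lamVec_inr_castLE (p := p) (by omega) hpq a b ⟨0, by omega⟩
  have l₂ := lamVec_inr_castLE (p := p) (by omega) hpq a b ⟨1, by omega⟩
  simp only [Fin.castLE_mk, Fin.mk.injEq, one_ne_zero, if_true, if_false] at l₁ l₂
  simp only [Fin.castLE_mk, map_add, map_smul, rotR_pow_eVec_zero, rotR_pow_fVec_zero,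
    formB_eVec, formB_fVec, lamVec_inl, l₁, l₂, smul_eq_mul, Fin.mk.injEq, one_ne_zero,
    if_true, if_false] at hP
  have hsq := Real.sin_sq_add_cos_sq (k * θ)
  have hB : formB p q
      ((rotR p q hp (hp.trans hpq) θ ^ k) (x • eVec p q ⟨0, by omega⟩ +
        y • fVec p q (Fin.castLE hpq ⟨0, by omega⟩)))
      ((rotR p q hp (hp.trans hpq) θ ^ k) (x • eVec p q ⟨0, by omega⟩ +
        y • fVec p q (Fin.castLE hpq ⟨0, by omega⟩))) = x ^ 2 - y ^ 2 := by
    simp only [Fin.castLE_mk, map_add, map_smul, rotR_pow_eVec_zero, rotR_pow_fVec_zero,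
      LinearMap.add_apply, LinearMap.smul_apply, formB_eVec, formB_fVec, smul_eq_mul]
    simp [eVec, fVec]
    linear_combination (x ^ 2 - y ^ 2) * hsq
  rw [hB]
  rw [← Real.tan_mul_cos hc] at hP
  have hx : b * x = (a + Real.tan (k * θ)) * y :=
    mul_right_cancel₀ hc (by linear_combination hP)
  have ht : (a + Real.tan (k * θ)) ^ 2 ≤ b ^ 2 := sq_le_sq' (by linarith) (by linarith)
  have hxy : b ^ 2 * x ^ 2 ≤ b ^ 2 * y ^ 2 := by
    rw [← mul_pow, hx, mul_pow]
    gcongr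
  linarith [le_of_mul_le_mul_left hxy (by positivity)]
end

section
/- With the standard setup below, let n ≥ 1 and suppose a > b > 0 with a² − b² = 1 and θ ∈ ℝ are such that for all k ∈ {1,…,n}, cos(kθ) ≠ 0 and −(a+b) ≤ tan(kθ) ≤ −(a−b). Then for all integers ℓ, k with 0 ≤ ℓ ≤ k ≤ n: there exists a p-dimensional positive-definite subspace V′ ⊆ r^ℓ(P) satisfying V′ = (V′ ∩ r^k U₁) ⊕ (V′ ∩ r^k U₂) ⊕ (V′ ∩ U₃) ⊕ ⋯ ⊕ (V′ ∩ U_p) if and only if k = ℓ. -/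
open Real

theorem formB_apply (p q : ℕ) (x y : (Fin p ⊕ Fin q) → ℝ) :
    formB p q x y = ∑ i, x (Sum.inl i) * y (Sum.inl i) - ∑ j, x (Sum.inr j) * y (Sum.inr j) := by
  simp [formB, Matrix.toLinearMap₂'_apply', dotProduct, Matrix.mulVec_diagonal, sigWeights,
    sub_eq_add_neg]

theorem rotR_apply (p q : ℕ) (hp : 2 ≤ p) (hq : 2 ≤ q) (θ : ℝ) (x : (Fin p ⊕ Fin q) → ℝ)
    (i : Fin p ⊕ Fin q) :
    rotR p q hp hq θ x i =
      if i = Sum.inl ⟨0, by omega⟩ then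
        cos θ * x (Sum.inl ⟨0, by omega⟩) - sin θ * x (Sum.inl ⟨1, by omega⟩)
      else if i = Sum.inl ⟨1, by omega⟩ then
        sin θ * x (Sum.inl ⟨0, by omega⟩) + cos θ * x (Sum.inl ⟨1, by omega⟩)
      else if i = Sum.inr ⟨0, by omega⟩ then
        cos θ * x (Sum.inr ⟨0, by omega⟩) - sin θ * x (Sum.inr ⟨1, by omega⟩)
      else if i = Sum.inr ⟨1, by omega⟩ then
        sin θ * x (Sum.inr ⟨0, by omega⟩) + cos θ * x (Sum.inr ⟨1, by omega⟩)
      else x i := by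
  obtain ⟨p, rfl⟩ := Nat.exists_eq_add_of_le' hp
  obtain ⟨q, rfl⟩ := Nat.exists_eq_add_of_le' hq
  rw [rotR, Module.Basis.constr_apply_fintype]
  simp only [Pi.basisFun_equivFun, LinearEquiv.refl_apply, Fintype.sum_sum_type,
    Fin.sum_univ_succ, Finset.sum_apply, Pi.smul_apply, smul_eq_mul, eVec, fVec]
  rcases i with i | i <;> refine Fin.cases ?_ (fun i => Fin.cases ?_ (fun i => ?_) i) i <;>
    simp [Fin.ext_iff, Pi.single_apply]
  any_goals ring1
  all_goals simp [← Fin.ext_iff]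

theorem rotR_mul (p q : ℕ) (hp : 2 ≤ p) (hq : 2 ≤ q) (α β : ℝ) :
    rotR p q hp hq α * rotR p q hp hq β = rotR p q hp hq (α + β) := by
  refine LinearMap.ext fun x => funext fun i => ?_
  simp only [Module.End.mul_apply, rotR_apply, cos_add, sin_add, Sum.inl.injEq, Sum.inr.injEq,
    reduceCtorEq, Fin.mk.injEq, one_ne_zero, zero_ne_one, if_false, if_true]
  split_ifs <;> ring

theorem rotR_zero (p q : ℕ) (hp : 2 ≤ p) (hq : 2 ≤ q) : rotR p q hp hq 0 = 1 := by
  refine LinearMap.ext fun x => funext fun i => ?_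
  simp only [rotR_apply, cos_zero, sin_zero, Module.End.one_apply]
  split_ifs with h₁ h₂ h₃ h₄ <;> simp [*]

theorem rotR_pow (p q : ℕ) (hp : 2 ≤ p) (hq : 2 ≤ q) (θ : ℝ) (k : ℕ) :
    rotR p q hp hq θ ^ k = rotR p q hp hq (k * θ) := by
  induction k with
  | zero => simp [rotR_zero]
  | succ k ih => rw [pow_succ, ih, rotR_mul]; push_cast; ring_nf

theorem formB_rotR (p q : ℕ) (hp : 2 ≤ p) (hq : 2 ≤ q) (θ : ℝ) (x y : (Fin p ⊕ Fin q) → ℝ) :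
    formB p q (rotR p q hp hq θ x) (rotR p q hp hq θ y) = formB p q x y := by
  obtain ⟨p, rfl⟩ := Nat.exists_eq_add_of_le' hp
  obtain ⟨q, rfl⟩ := Nat.exists_eq_add_of_le' hq
  simp only [formB_apply, rotR_apply, Fin.sum_univ_succ]
  simp [Fin.ext_iff]
  linear_combination (x (Sum.inl 0) * y (Sum.inl 0) + x (Sum.inl 1) * y (Sum.inl 1)
    - x (Sum.inr 0) * y (Sum.inr 0) - x (Sum.inr 1) * y (Sum.inr 1)) * sin_sq_add_cos_sq θ

theorem rotR_injective (p q : ℕ) (hp : 2 ≤ p) (hq : 2 ≤ q) (θ : ℝ) :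
    Function.Injective (rotR p q hp hq θ) := by
  refine Function.LeftInverse.injective (g := rotR p q hp hq (-θ)) fun x => ?_
  rw [← Module.End.mul_apply, rotR_mul, neg_add_cancel, rotR_zero, Module.End.one_apply]

theorem ExistsGoodSubspace.map {p q : ℕ} {P : Submodule ℝ ((Fin p ⊕ Fin q) → ℝ)}
    {W : Fin p → Submodule ℝ ((Fin p ⊕ Fin q) → ℝ)} (h : ExistsGoodSubspace p q P W)
    (g : Module.End ℝ ((Fin p ⊕ Fin q) → ℝ)) (hg : Function.Injective g)
    (hB : ∀ x y, formB p q (g x) (g y) = formB p q x y) :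
    ExistsGoodSubspace p q (P.map g) (fun i => (W i).map g) := by
  obtain ⟨V, hVP, hfin, hpos, hV⟩ := h
  refine ⟨V.map g, Submodule.map_mono hVP, ?_, ?_, ?_⟩
  · rw [← (Submodule.equivMapOfInjective g hg V).finrank_eq, hfin]
  · rintro _ ⟨v, hv, rfl⟩ hne
    rw [hB]
    exact hpos v hv fun h => hne (by rw [h, map_zero])
  · conv_lhs => rw [hV]
    rw [Submodule.map_iSup]
    exact iSup_congr fun i => Submodule.map_inf g hg

/-- A family that is orthonormal for `B` spans a positive definite subspace, of dimension the
size of the family. -/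
theorem formB_span_of_orthonormal {p q : ℕ} {ι : Type*} [Fintype ι] [DecidableEq ι]
    {u : ι → (Fin p ⊕ Fin q) → ℝ}
    (hu : ∀ i j, formB p q (u i) (u j) = if i = j then 1 else 0) :
    Module.finrank ℝ (Submodule.span ℝ (Set.range u)) = Fintype.card ι ∧
      ∀ v ∈ Submodule.span ℝ (Set.range u), v ≠ 0 → 0 < formB p q v v := by
  constructor
  · refine finrank_span_eq_card (LinearMap.linearIndependent_of_isOrthoᵢ (B := formB p q)
      (fun i j hij => ?_) fun i => ?_)
    · exact (hu i j).trans (if_neg hij)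
    · simp [hu]
  · intro v hv hne
    obtain ⟨c, rfl⟩ := (Submodule.mem_span_range_iff_exists_fun ℝ).1 hv
    have hB : formB p q (∑ i, c i • u i) (∑ i, c i • u i) = ∑ i, c i ^ 2 := by
      simp [LinearMap.sum_apply, hu, sq]
    rw [hB]
    obtain ⟨i, hi⟩ : ∃ i, c i ≠ 0 := by
      by_contra! h
      exact hne (by simp [h])
    exact Finset.sum_pos' (fun j _ => sq_nonneg _) ⟨i, Finset.mem_univ i, by positivity⟩

theorem finrank_iSup_le_sum {K V ι : Type*} [Field K] [AddCommGroup V] [Module K V]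
    [FiniteDimensional K V] [Fintype ι] (S : ι → Submodule K V) :
    Module.finrank K ↥(⨆ i, S i) ≤ ∑ i, Module.finrank K (S i) := by
  classical
  rw [← Finset.sup_univ_eq_iSup]
  induction (Finset.univ : Finset ι) using Finset.induction_on with
  | empty => simp
  | insert i s hi ih =>
    rw [Finset.sup_insert, Finset.sum_insert hi]
    exact (Submodule.finrank_add_le_finrank_add_finrank _ _).trans (by gcongr)

/-- If the subspaces `W i` are at most two-dimensional and each contains a vector on which `B` is
not positive, then a good subspace meets every `W i` nontrivially. -/
theorem ExistsGoodSubspace.exists_mem {p q : ℕ} {P : Submodule ℝ ((Fin p ⊕ Fin q) → ℝ)}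
    {W : Fin p → Submodule ℝ ((Fin p ⊕ Fin q) → ℝ)} (h : ExistsGoodSubspace p q P W)
    (hW : ∀ i, Module.finrank ℝ (W i) ≤ 2)
    (hneg : ∀ i, ∃ w ∈ W i, formB p q w w < 0) (i : Fin p) :
    ∃ v ∈ W i, v ∈ P ∧ 0 < formB p q v v := by
  obtain ⟨V, hVP, hfin, hpos, hV⟩ := h
  by_contra! hno
  have hle : ∀ j, Module.finrank ℝ ↥(V ⊓ W j) ≤ 1 := fun j => by
    obtain ⟨w, hw, hwneg⟩ := hneg j
    have hlt : V ⊓ W j < W j := by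
      refine inf_lt_right.2 fun hWV => ?_
      have := hpos w (hWV hw) (by rintro rfl; simp at hwneg)
      linarith
    have := (Submodule.finrank_lt_finrank_of_lt hlt).trans_le (hW j)
    omega
  have hbot : V ⊓ W i = ⊥ := by
    refine (Submodule.eq_bot_iff _).2 fun v hv => ?_
    by_contra hne
    exact (hpos v hv.1 hne).not_ge (hno v hv.2 (hVP hv.1))
  have hsum : ∑ j, Module.finrank ℝ ↥(V ⊓ W j) < ∑ _j : Fin p, 1 :=
    Finset.sum_lt_sum (fun j _ => hle j) ⟨i, Finset.mem_univ i, by rw [hbot]; simp⟩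
  have := finrank_iSup_le_sum fun j => V ⊓ W j
  rw [← hV, hfin] at this
  simp at hsum
  omega

theorem finrank_planeU_le (p q : ℕ) (hpq : p ≤ q) (i : Fin p) :
    Module.finrank ℝ (planeU p q hpq i) ≤ 2 := by
  classical
  have := finrank_span_finset_le_card (R := ℝ) {eVec p q i, fVec p q (Fin.castLE hpq i)}
  rw [Finset.coe_pair] at this
  exact this.trans Finset.card_le_two

theorem formB_fVec_self (p q : ℕ) (j : Fin q) : formB p q (fVec p q j) (fVec p q j) = -1 := by
  simp [formB_apply, fVec, Pi.single_apply]

theorem formB_lamVec (p q : ℕ) (hp : 0 < p) (hpq : p ≤ q) (a b : ℝ) (x : (Fin p ⊕ Fin q) → ℝ) :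
    formB p q (lamVec p q hp hpq a b) x =
      b * x (Sum.inl ⟨0, hp⟩) - a * x (Sum.inr (Fin.castLE hpq ⟨0, hp⟩)) -
        ∑ j ∈ Finset.univ.erase (⟨0, hp⟩ : Fin p), x (Sum.inr (Fin.castLE hpq j)) := by
  have he : ∀ i, formB p q (eVec p q i) x = x (Sum.inl i) := fun i => by
    simp [formB_apply, eVec, Pi.single_apply]
  have hf : ∀ j, formB p q (fVec p q j) x = -x (Sum.inr j) := fun j => by
    simp [formB_apply, fVec, Pi.single_apply]
  simp only [lamVec, map_add, map_smul, map_sum, LinearMap.add_apply, LinearMap.smul_apply,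
    LinearMap.sum_apply, he, hf, smul_eq_mul, Finset.sum_neg_distrib]
  ring

theorem map_rotR_planeU (p q : ℕ) (hp : 2 ≤ p) (hpq : p ≤ q) (α : ℝ) (i : Fin p)
    (h₀ : i ≠ ⟨0, by omega⟩) (h₁ : i ≠ ⟨1, by omega⟩) :
    (planeU p q hpq i).map (rotR p q hp (hp.trans hpq) α) = planeU p q hpq i := by
  rw [Ne, Fin.ext_iff] at h₀ h₁
  have he : rotR p q hp (hp.trans hpq) α (eVec p q i) = eVec p q i := by
    ext j
    rw [rotR_apply]
    split_ifs <;> simp_all [eVec, Pi.single_apply, Fin.ext_iff, eq_comm]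
  have hf : rotR p q hp (hp.trans hpq) α (fVec p q (Fin.castLE hpq i)) =
      fVec p q (Fin.castLE hpq i) := by
    ext j
    rw [rotR_apply]
    split_ifs <;> simp_all [fVec, Pi.single_apply, Fin.ext_iff, eq_comm]
  rw [planeU, Submodule.map_span, Set.image_pair, he, hf]

theorem existsGoodSubspace_planeU (p q : ℕ) (hp : 0 < p) (hpq : p ≤ q) (a b : ℝ)
    (hab : a ^ 2 - b ^ 2 = 1) :
    ExistsGoodSubspace p q (hyperP p q hp hpq a b) (planeU p q hpq) := by
  let u : Fin p → (Fin p ⊕ Fin q) → ℝ := fun i =>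
    if i = ⟨0, hp⟩ then a • eVec p q i + b • fVec p q (Fin.castLE hpq i) else eVec p q i
  have huU : ∀ i, u i ∈ planeU p q hpq i := fun i => by
    have he : eVec p q i ∈ planeU p q hpq i := Submodule.subset_span (by simp)
    have hf : fVec p q (Fin.castLE hpq i) ∈ planeU p q hpq i := Submodule.subset_span (by simp)
    by_cases hi : i = ⟨0, hp⟩
    · simp only [u, if_pos hi]
      exact add_mem (Submodule.smul_mem _ _ he) (Submodule.smul_mem _ _ hf)
    · simpa only [u, if_neg hi] using he
  have huB : ∀ i j, formB p q (u i) (u j) = if i = j then 1 else 0 := fun i j => by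
    by_cases hi : i = ⟨0, hp⟩ <;> by_cases hj : j = ⟨0, hp⟩ <;>
      simp [u, hi, hj, formB_apply, eVec, fVec, Pi.single_apply, eq_comm]
    linarith
  obtain ⟨hfin, hpos⟩ := formB_span_of_orthonormal huB
  refine ⟨Submodule.span ℝ (Set.range u), ?_, by simpa using hfin, hpos, le_antisymm ?_ ?_⟩
  · rw [Submodule.span_le]
    rintro _ ⟨i, rfl⟩
    rw [SetLike.mem_coe, hyperP, LinearMap.mem_ker, formB_lamVec]
    by_cases hi : i = ⟨0, hp⟩
    · rw [Finset.sum_eq_zero fun j hj => ?_]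
      · simp [u, hi, eVec, fVec]
        ring
      · have hj₀ := Finset.ne_of_mem_erase hj
        rw [Ne, Fin.ext_iff] at hj₀
        simp_all [u, eVec, fVec, Fin.ext_iff]
    · simp [u, hi, eVec, eq_comm]
  · rw [Submodule.span_le]
    rintro _ ⟨i, rfl⟩
    exact Submodule.mem_iSup_of_mem i ⟨Submodule.subset_span ⟨i, rfl⟩, huU i⟩
  · exact iSup_le fun i => inf_le_left

theorem formB_nonpos_of_mem_map_rotR (p q : ℕ) (hp : 2 ≤ p) (hpq : p ≤ q) {a b α : ℝ}
    (hb : 0 < b) (hα : cos α ≠ 0) (hl : -(a + b) ≤ tan α) (hu : tan α ≤ -(a - b))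
    {v : (Fin p ⊕ Fin q) → ℝ}
    (hv : v ∈ (planeU p q hpq ⟨0, by omega⟩).map (rotR p q hp (hp.trans hpq) α))
    (hvP : v ∈ hyperP p q (by omega) hpq a b) : formB p q v v ≤ 0 := by
  obtain ⟨w, hw, rfl⟩ := hv
  obtain ⟨x, y, rfl⟩ := Submodule.mem_span_pair.1 hw
  have hB : formB p q (x • eVec p q ⟨0, by omega⟩ + y • fVec p q (Fin.castLE hpq ⟨0, by omega⟩))
      (x • eVec p q ⟨0, by omega⟩ + y • fVec p q (Fin.castLE hpq ⟨0, by omega⟩)) =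
      x ^ 2 - y ^ 2 := by
    simp [formB_apply, eVec, fVec, Pi.single_apply]
    ring
  have hker : b * (cos α * x) - a * (cos α * y) - sin α * y = 0 := by
    rw [hyperP, LinearMap.mem_ker, formB_lamVec, Finset.sum_eq_single ⟨1, by omega⟩] at hvP
    · simpa [rotR_apply, eVec, fVec, Pi.single_apply, Fin.ext_iff] using hvP
    · intro j hj hj₁
      have hj₀ := Finset.ne_of_mem_erase hj
      rw [Ne, Fin.ext_iff] at hj₀ hj₁
      simp_all [rotR_apply, eVec, fVec, Fin.ext_iff]
    · simp [Fin.ext_iff]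
  rw [formB_rotR, hB]
  have hxy : b * x = (a + tan α) * y := by
    rw [← tan_mul_cos hα] at hker
    refine mul_left_cancel₀ hα ?_
    linarith
  have hsq : (a + tan α) ^ 2 ≤ b ^ 2 := sq_le_sq' (by linarith) (by linarith)
  have : b ^ 2 * (x ^ 2 - y ^ 2) ≤ b ^ 2 * 0 := by
    have := mul_le_mul_of_nonneg_right hsq (sq_nonneg y)
    linear_combination this + (b * x + (a + tan α) * y) * hxy
  exact le_of_mul_le_mul_left this (by positivity)

/-- the lower-triangular intersection pattern of the arrangement of flats and
hyperplanes. With `2 ≤ p ≤ q`, suppose `a > b > 0` with `a² − b² = 1` and `θ ∈ ℝ` satisfy, for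
all `k ∈ {1, …, n}`, `cos (kθ) ≠ 0` and `−(a+b) ≤ tan (kθ) ≤ −(a−b)`. Then for all
`0 ≤ ℓ ≤ k ≤ n`, a `p`-dimensional positive-definite subspace `V' ⊆ r^ℓ(P)` with
`V' = (V' ∩ r^k U₁) ⊕ (V' ∩ r^k U₂) ⊕ (V' ∩ U₃) ⊕ ⋯ ⊕ (V' ∩ U_p)` exists iff `k = ℓ`. -/
theorem arrangement_intersection_pattern
    (p q : ℕ) (hp : 2 ≤ p) (hpq : p ≤ q) (n : ℕ) (hn : 1 ≤ n) (a b θ : ℝ)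
    (hba : b < a) (hb : 0 < b) (hab : a ^ 2 - b ^ 2 = 1)
    (hk : ∀ k : ℕ, 1 ≤ k → k ≤ n →
      Real.cos (k * θ) ≠ 0 ∧ -(a + b) ≤ Real.tan (k * θ) ∧ Real.tan (k * θ) ≤ -(a - b)) :
    ∀ ℓ k : ℕ, ℓ ≤ k → k ≤ n →
      (ExistsGoodSubspace p q
        ((hyperP p q (by omega) hpq a b).map (rotR p q hp (hp.trans hpq) θ ^ ℓ))
        (fun i : Fin p =>
          if i = ⟨0, by omega⟩ then
            (planeU p q hpq ⟨0, by omega⟩).map (rotR p q hp (hp.trans hpq) θ ^ k)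
          else if i = ⟨1, by omega⟩ then
            (planeU p q hpq ⟨1, by omega⟩).map (rotR p q hp (hp.trans hpq) θ ^ k)
          else planeU p q hpq i) ↔ k = ℓ) := by
  intro ℓ k hℓk hkn
  have hp₀ : 0 < p := by omega
  have hW : (fun i : Fin p =>
      if i = ⟨0, by omega⟩ then
        (planeU p q hpq ⟨0, by omega⟩).map (rotR p q hp (hp.trans hpq) θ ^ k)
      else if i = ⟨1, by omega⟩ then
        (planeU p q hpq ⟨1, by omega⟩).map (rotR p q hp (hp.trans hpq) θ ^ k)
      else planeU p q hpq i) =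
      fun i => (planeU p q hpq i).map (rotR p q hp (hp.trans hpq) (k * θ)) := by
    funext i
    rw [rotR_pow]
    split_ifs with h₀ h₁
    · rw [h₀]
    · rw [h₁]
    · rw [map_rotR_planeU p q hp hpq _ i h₀ h₁]
  rw [hW, rotR_pow]
  constructor
  · intro h
    by_contra hne
    have h' := h.map (rotR p q hp (hp.trans hpq) (-(ℓ * θ))) (rotR_injective ..)
      (formB_rotR p q hp _ _)
    have hcomp : ∀ (S : Submodule ℝ ((Fin p ⊕ Fin q) → ℝ)) (β : ℝ),
        (S.map (rotR p q hp (hp.trans hpq) β)).map (rotR p q hp (hp.trans hpq) (-(ℓ * θ))) =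
          S.map (rotR p q hp (hp.trans hpq) (-(ℓ * θ) + β)) := fun S β => by
      rw [← rotR_mul, Module.End.mul_eq_comp, Submodule.map_comp]
    have hangle : -(ℓ * θ) + k * θ = ((k - ℓ : ℕ) : ℝ) * θ := by
      rw [Nat.cast_sub hℓk]
      ring
    simp only [hcomp, hangle, neg_add_cancel, rotR_zero] at h'
    rw [Module.End.one_eq_id, Submodule.map_id] at h'
    obtain ⟨hcos, hl, hu⟩ := hk (k - ℓ) (by omega) (by omega)
    obtain ⟨v, hvW, hvP, hv⟩ := h'.exists_mem
      (fun i => (Submodule.finrank_map_le _ _).trans (finrank_planeU_le p q hpq i))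
      (fun i => ⟨_, Submodule.mem_map_of_mem (Submodule.subset_span (Set.mem_insert_of_mem _ rfl)),
        by rw [formB_rotR, formB_fVec_self]; norm_num⟩) ⟨0, hp₀⟩
    exact hv.not_ge (formB_nonpos_of_mem_map_rotR p q hp hpq hb hcos hl hu hvW hvP)
  · rintro rfl
    exact (existsGoodSubspace_planeU p q hp₀ hpq a b hab).map _ (rotR_injective ..)
      (formB_rotR p q hp _ _)
end
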